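/- Let n, r, s be nonnegative integers, let a, b, c, p, x ∈ ℂ and a₁,…,a_r, b₁,…,b_s ∈ ℂ. Assume ab + p(c−a−b−1) ≠ 0 and set γ = p(c−a−1)(c−b−1)/(ab + p(c−a−b−1)). Assume the parameters are nondegenerate for the identity below. Then the terminating sum ᵣ₊₄Fₛ₊₂(a, b, p+1, a₁,…,a_r, −n; c, p, b₁,…,b_s; x) equals Σ_{m=0}^{n} [ (c−a−1)_m (c−b−1)_m (γ+1)_m (a₁)_m⋯(a_r)_m (−n)_m x^m / ( m! (c)_m (γ)_m (b₁)_m⋯(b_s)_m ) ] · ᵣ₊₂Fₛ(1+a+b−c, a₁+m, …, a_r+m, −(n−m); b₁+m, …, b_s+m; x). -/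

import Mathlib

/-- Rising factorial (Pochhammer symbol) `(a)ₖ = a(a+1)⋯(a+k−1)`. -/
noncomputable def poch (a : ℂ) (k : ℕ) : ℂ := (ascPochhammer ℂ k).eval a

/-- Terminating hypergeometric sum with numerator parameters `A` together with
the extra top parameter `-n`, denominator parameters `B`, and argument `x`. -/
noncomputable def hypTerm (A B : List ℂ) (n : ℕ) (x : ℂ) : ℂ :=
  ∑ k ∈ Finset.range (n + 1),
    ((A.map fun a => poch a k).prod * poch (-(n : ℂ)) k) /
      ((k.factorial : ℂ) * (B.map fun b => poch b k).prod) * x ^ k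

lemma poch_zero (a : ℂ) : poch a 0 = 1 := by simp [poch]

lemma poch_succ (a : ℂ) (k : ℕ) : poch a (k + 1) = poch a k * (a + k) := by
  simp [poch, ascPochhammer_succ_eval]

lemma poch_add (a : ℂ) (m j : ℕ) : poch a (m + j) = poch a m * poch (a + m) j := by
  induction j with
  | zero => simp [poch_zero]
  | succ j ih =>
    rw [← add_assoc, poch_succ, poch_succ, ih]
    push_cast
    ring

lemma poch_succ_left (a : ℂ) (k : ℕ) : poch a (k + 1) = a * poch (a + 1) k := by
  rw [add_comm k 1, poch_add, poch_succ, poch_zero]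
  simp

lemma poch_add_one_mul (p : ℂ) (k : ℕ) : poch (p + 1) k * p = poch p k * (p + k) := by
  rw [← poch_succ, poch_succ_left, mul_comm]

/-- The `k`-th coefficient of `₂F₁(a, b; c; x)`. -/
noncomputable def gaussCoeff (a b c : ℂ) (k : ℕ) : ℂ :=
  poch a k * poch b k / (k.factorial * poch c k)

/-- The `k`-th coefficient of `(1 - x)^(-e)`. -/
noncomputable def binomCoeff (e : ℂ) (k : ℕ) : ℂ := poch e k / k.factorial

lemma gaussCoeff_zero (a b c : ℂ) : gaussCoeff a b c 0 = 1 := by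
  simp [gaussCoeff, poch_zero]

lemma binomCoeff_zero (e : ℂ) : binomCoeff e 0 = 1 := by
  simp [binomCoeff, poch_zero]

lemma gaussCoeff_succ (a b c : ℂ) (k : ℕ) (hc : poch c (k + 1) ≠ 0) :
    (k + 1) * (c + k) * gaussCoeff a b c (k + 1) = (a + k) * (b + k) * gaussCoeff a b c k := by
  rw [poch_succ] at hc
  have h1 := left_ne_zero_of_mul hc
  have h2 := right_ne_zero_of_mul hc
  have h3 : (k.factorial : ℂ) ≠ 0 := by exact_mod_cast k.factorial_ne_zero
  have h4 : (k : ℂ) + 1 ≠ 0 := by exact_mod_cast k.succ_ne_zero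
  simp only [gaussCoeff, poch_succ, Nat.factorial_succ]
  push_cast
  field_simp

lemma gaussCoeff_succ_left (a b c : ℂ) (k : ℕ) :
    (k + 1) * gaussCoeff a b c (k + 1) = a * b / c * gaussCoeff (a + 1) (b + 1) (c + 1) k := by
  have h4 : (k : ℂ) + 1 ≠ 0 := by exact_mod_cast k.succ_ne_zero
  simp only [gaussCoeff, poch_succ_left, Nat.factorial_succ]
  push_cast
  field_simp

lemma binomCoeff_succ (e : ℂ) (k : ℕ) :
    (k + 1) * binomCoeff e (k + 1) = (e + k) * binomCoeff e k := by
  have h4 : (k : ℂ) + 1 ≠ 0 := by exact_mod_cast k.succ_ne_zero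
  simp only [binomCoeff, poch_succ, Nat.factorial_succ]
  push_cast
  field_simp

lemma binomCoeff_succ_sub (e : ℂ) (k : ℕ) :
    binomCoeff (e + 1) (k + 1) - binomCoeff (e + 1) k = binomCoeff e (k + 1) := by
  have h3 : (k.factorial : ℂ) ≠ 0 := by exact_mod_cast k.factorial_ne_zero
  have h4 : (k : ℂ) + 1 ≠ 0 := by exact_mod_cast k.succ_ne_zero
  simp only [binomCoeff, Nat.factorial_succ]
  rw [poch_succ_left e, poch_succ]
  push_cast
  field_simp
  ring

lemma poch_ne_zero_of_le {c : ℂ} {m k : ℕ} (hmk : m ≤ k) (hc : poch c k ≠ 0) :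
    poch c m ≠ 0 := by
  obtain ⟨j, rfl⟩ := Nat.exists_eq_add_of_le hmk
  rw [poch_add] at hc
  exact left_ne_zero_of_mul hc

/-- Telescoping form of the recurrence behind Euler's transformation. -/
lemma sum_range_gaussCoeff_mul_binomCoeff_telescope (a b c : ℂ) (k : ℕ)
    (hc : poch c (k + 1) ≠ 0) (M : ℕ) (hM : M ≤ k + 1) :
    ∑ m ∈ Finset.range M,
      ((k + 1) * (c + k) * (gaussCoeff a b c m * binomCoeff (c - a - b) (k + 1 - m)) -
        (c - a + k) * (c - b + k) * (gaussCoeff a b c m * binomCoeff (c - a - b) (k - m))) =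
      -(M * (c + M - 1) * (gaussCoeff a b c M * binomCoeff (c - a - b) (k + 1 - M))) := by
  induction M with
  | zero => simp
  | succ M ih =>
    rw [Finset.sum_range_succ, ih (by omega)]
    obtain ⟨j, rfl⟩ := Nat.exists_eq_add_of_le (show M ≤ k by omega)
    have hg := gaussCoeff_succ a b c M (poch_ne_zero_of_le hM hc)
    have hv := binomCoeff_succ (c - a - b) j
    have e1 : M + j + 1 - M = j + 1 := by omega
    have e2 : M + j + 1 - (M + 1) = j := by omega
    have e3 : M + j - M = j := by omega
    rw [e1, e2, e3]
    push_cast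
    linear_combination (binomCoeff (c - a - b) j) * hg +
      (c + 2 * M + j) * gaussCoeff a b c M * hv

/-- Euler's transformation of `₂F₁`, coefficientwise. -/
lemma sum_range_gaussCoeff_mul_binomCoeff (a b c : ℂ) (k : ℕ) (hc : poch c k ≠ 0) :
    ∑ m ∈ Finset.range (k + 1), gaussCoeff a b c m * binomCoeff (c - a - b) (k - m) =
      gaussCoeff (c - a) (c - b) c k := by
  induction k with
  | zero => simp [gaussCoeff_zero, binomCoeff_zero]
  | succ k ih =>
    have h := sum_range_gaussCoeff_mul_binomCoeff_telescope a b c k hc (k + 1) le_rfl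
    rw [Finset.sum_sub_distrib, ← Finset.mul_sum, ← Finset.mul_sum,
      ih (poch_ne_zero_of_le k.le_succ hc)] at h
    have hg := gaussCoeff_succ (c - a) (c - b) c k hc
    rw [poch_succ] at hc
    have h4 : (k : ℂ) + 1 ≠ 0 := by exact_mod_cast k.succ_ne_zero
    apply mul_left_cancel₀ (mul_ne_zero h4 (right_ne_zero_of_mul hc))
    rw [Finset.sum_range_succ]
    rw [Nat.sub_self] at h ⊢
    push_cast at h
    linear_combination h - hg

lemma sum_range_gaussCoeff_mul_binomCoeff_sub_one (a b c : ℂ) (k : ℕ)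
    (hc : poch c (k + 1) ≠ 0) :
    ∑ m ∈ Finset.range (k + 2), gaussCoeff a b c m * binomCoeff (c - a - b - 1) (k + 1 - m) =
      gaussCoeff (c - a) (c - b) c (k + 1) - gaussCoeff (c - a) (c - b) c k := by
  rw [← sum_range_gaussCoeff_mul_binomCoeff a b c (k + 1) hc,
    ← sum_range_gaussCoeff_mul_binomCoeff a b c k (poch_ne_zero_of_le k.le_succ hc),
    Finset.sum_range_succ, Finset.sum_range_succ _ (k + 1), add_sub_right_comm,
    ← Finset.sum_sub_distrib]
  congr 1
  · refine Finset.sum_congr rfl fun m hm => ?_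
    rw [Nat.succ_sub (Finset.mem_range_succ_iff.mp hm), ← mul_sub,
      ← binomCoeff_succ_sub, sub_add_cancel]
  · simp [binomCoeff_zero]

lemma sum_range_mul_gaussCoeff_mul_binomCoeff (a b c : ℂ) (k : ℕ)
    (hc : poch c (k + 1) ≠ 0) :
    ∑ m ∈ Finset.range (k + 2),
        m * (gaussCoeff a b c m * binomCoeff (c - a - b - 1) (k + 1 - m)) =
      a * b / c * gaussCoeff (c - a) (c - b) (c + 1) k := by
  rw [poch_succ_left] at hc
  have h := sum_range_gaussCoeff_mul_binomCoeff (a + 1) (b + 1) (c + 1) k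
    (right_ne_zero_of_mul hc)
  rw [add_sub_add_right_eq_sub, add_sub_add_right_eq_sub] at h
  rw [← h, Finset.sum_range_succ', Finset.mul_sum]
  simp only [Nat.cast_zero, zero_mul, add_zero]
  refine Finset.sum_congr rfl fun m _ => ?_
  rw [Nat.add_sub_add_right, ← mul_assoc, ← mul_assoc, ← gaussCoeff_succ_left,
    show c - a - (b + 1) = c - a - b - 1 by ring]
  push_cast
  ring

/-- The transformation of `₃F₂(a, b, p + 1; c, p; x)`, coefficientwise. -/
lemma gaussCoeff_mul_poch_add_one_div (a b c p γ : ℂ) (k : ℕ)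
    (hab : a * b + p * (c - a - b - 1) ≠ 0)
    (hγ : γ = p * (c - a - 1) * (c - b - 1) / (a * b + p * (c - a - b - 1)))
    (hc : poch c k ≠ 0) (hp : poch p k ≠ 0) (hγk : ∀ m ≤ k, poch γ m ≠ 0) :
    gaussCoeff a b c k * (poch (p + 1) k / poch p k) =
      ∑ m ∈ Finset.range (k + 1), gaussCoeff (c - a - 1) (c - b - 1) c m *
        (poch (γ + 1) m / poch γ m) * binomCoeff (1 + a + b - c) (k - m) := by
  cases k with
  | zero => simp [poch_zero, gaussCoeff_zero, binomCoeff_zero]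
  | succ K =>
    have hp0 : p ≠ 0 := by
      rw [poch_succ_left] at hp
      exact left_ne_zero_of_mul hp
    have hc0 : c ≠ 0 := by
      rw [poch_succ_left] at hc
      exact left_ne_zero_of_mul hc
    have hγ0 : γ ≠ 0 := by
      have := hγk (K + 1) le_rfl
      rw [poch_succ_left] at this
      exact left_ne_zero_of_mul this
    have ratio : ∀ (z : ℂ) (m : ℕ), z ≠ 0 → poch z m ≠ 0 →
        poch (z + 1) m / poch z m = 1 + m * z⁻¹ := by
      intro z m hz hzm
      have := poch_add_one_mul z m
      field_simp
      linear_combination this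
    have hinv : (c - a - 1) * (c - b - 1) * γ⁻¹ = (a * b + p * (c - a - b - 1)) / p := by
      have : γ * (a * b + p * (c - a - b - 1)) = p * (c - a - 1) * (c - b - 1) := by
        rw [hγ, div_mul_cancel₀ _ hab]
      field_simp
      linear_combination -this
    have h1 := sum_range_gaussCoeff_mul_binomCoeff_sub_one (c - a - 1) (c - b - 1) c K hc
    have h2 := sum_range_mul_gaussCoeff_mul_binomCoeff (c - a - 1) (c - b - 1) c K hc
    rw [show c - (c - a - 1) = a + 1 by ring, show c - (c - b - 1) = b + 1 by ring,
      show a + 1 - (c - b - 1) - 1 = 1 + a + b - c by ring] at h1 h2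
    have hsum : ∑ m ∈ Finset.range (K + 1 + 1), gaussCoeff (c - a - 1) (c - b - 1) c m *
        (poch (γ + 1) m / poch γ m) * binomCoeff (1 + a + b - c) (K + 1 - m) =
        (gaussCoeff (a + 1) (b + 1) c (K + 1) - gaussCoeff (a + 1) (b + 1) c K) +
        γ⁻¹ * ((c - a - 1) * (c - b - 1) / c * gaussCoeff (a + 1) (b + 1) (c + 1) K) := by
      rw [← h1, ← h2, Finset.mul_sum, ← Finset.sum_add_distrib]
      refine Finset.sum_congr rfl fun m hm => ?_
      rw [ratio γ m hγ0 (hγk m (Finset.mem_range_succ_iff.mp hm))]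
      ring
    rw [hsum, ratio p _ hp0 hp]
    have h4 : (K : ℂ) + 1 ≠ 0 := by exact_mod_cast K.succ_ne_zero
    have g1 := gaussCoeff_succ_left a b c K
    have g2 := gaussCoeff_succ (a + 1) (b + 1) c K hc
    have g3 : c * gaussCoeff (a + 1) (b + 1) c K =
        (c + K) * gaussCoeff (a + 1) (b + 1) (c + 1) K := by
      have hc1 := hc
      rw [poch_succ_left] at hc1
      have hck := poch_ne_zero_of_le K.le_succ hc
      have hck1 := right_ne_zero_of_mul hc1
      have hpoch := poch_add_one_mul c K
      have h3 : (K.factorial : ℂ) ≠ 0 := by exact_mod_cast K.factorial_ne_zero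
      simp only [gaussCoeff]
      field_simp
      linear_combination poch (a + 1) K * poch (b + 1) K * hpoch
    have hcK : c + K ≠ 0 := by
      rw [poch_succ] at hc
      exact right_ne_zero_of_mul hc
    have e1 : gaussCoeff a b c (K + 1) =
        a * b / (c * (K + 1)) * gaussCoeff (a + 1) (b + 1) (c + 1) K := by
      apply mul_left_cancel₀ h4
      rw [g1]
      field_simp
    have e3 : gaussCoeff (a + 1) (b + 1) c K =
        (c + K) / c * gaussCoeff (a + 1) (b + 1) (c + 1) K := by
      apply mul_left_cancel₀ hc0
      rw [g3]
      field_simp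
    have e2 : gaussCoeff (a + 1) (b + 1) c (K + 1) = (a + 1 + K) * (b + 1 + K) / (c * (K + 1)) *
        gaussCoeff (a + 1) (b + 1) (c + 1) K := by
      apply mul_left_cancel₀ (mul_ne_zero h4 hcK)
      rw [g2, e3]
      field_simp
    have e4 : γ⁻¹ * ((c - a - 1) * (c - b - 1) / c * gaussCoeff (a + 1) (b + 1) (c + 1) K) =
        (a * b + p * (c - a - b - 1)) / p / c * gaussCoeff (a + 1) (b + 1) (c + 1) K := by
      rw [← hinv]
      ring
    rw [e4, e1, e2, e3]
    push_cast
    field_simp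
    ring

lemma prod_poch_add {r : ℕ} (A : Fin r → ℂ) (m j : ℕ) :
    ∏ i, poch (A i) (m + j) = (∏ i, poch (A i) m) * ∏ i, poch (A i + m) j := by
  simp only [poch_add, Finset.prod_mul_distrib]

theorem proposition_12P1 (n r s : ℕ) (a b c p x : ℂ) (A : Fin r → ℂ) (B : Fin s → ℂ)
    (hab : a * b + p * (c - a - b - 1) ≠ 0) (γ : ℂ)
    (hγ : γ = p * (c - a - 1) * (c - b - 1) / (a * b + p * (c - a - b - 1)))
    (hnd : ∀ z ∈ [c, p, γ], ∀ k ≤ n, poch z k ≠ 0)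
    (hB : ∀ i : Fin s, ∀ m k : ℕ, m + k ≤ n → poch (B i + (m : ℂ)) k ≠ 0) :
    hypTerm ([a, b, p + 1] ++ List.ofFn A) ([c, p] ++ List.ofFn B) n x
      = ∑ m ∈ Finset.range (n + 1),
          (poch (c - a - 1) m * poch (c - b - 1) m * poch (γ + 1) m *
              (List.ofFn fun i => poch (A i) m).prod * poch (-(n : ℂ)) m * x ^ m) /
            ((m.factorial : ℂ) * poch c m * poch γ m *
              (List.ofFn fun i => poch (B i) m).prod) *
          hypTerm ((1 + a + b - c) :: List.ofFn (fun i => A i + (m : ℂ)))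
            (List.ofFn (fun i => B i + (m : ℂ))) (n - m) x := by
  have hγn := hnd γ (by simp)
  simp only [hypTerm, List.map_append, List.map_cons, List.map_nil, List.map_ofFn,
    List.prod_append, List.prod_cons, List.prod_nil, List.prod_ofFn, Function.comp_def, mul_one]
  let F : ℕ → ℕ → ℂ := fun m j =>
    (gaussCoeff (c - a - 1) (c - b - 1) c m * (poch (γ + 1) m / poch γ m) *
      binomCoeff (1 + a + b - c) j) *
      ((∏ i, poch (A i) (m + j)) * poch (-(n : ℂ)) (m + j) / (∏ i, poch (B i) (m + j)) *
        x ^ (m + j))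
  trans ∑ k ∈ Finset.range (n + 1), ∑ m ∈ Finset.range (k + 1), F m (k - m)
  · refine Finset.sum_congr rfl fun k hk => ?_
    have hkn := Finset.mem_range_succ_iff.mp hk
    have h := gaussCoeff_mul_poch_add_one_div a b c p γ k hab hγ (hnd c (by simp) k hkn)
      (hnd p (by simp) k hkn) fun m hm => hγn m (hm.trans hkn)
    have hF : ∑ m ∈ Finset.range (k + 1), F m (k - m) =
        gaussCoeff a b c k * (poch (p + 1) k / poch p k) *
          ((∏ i, poch (A i) k) * poch (-(n : ℂ)) k / (∏ i, poch (B i) k) * x ^ k) := by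
      rw [h, Finset.sum_mul]
      refine Finset.sum_congr rfl fun m hm => ?_
      simp only [F, Nat.add_sub_cancel' (Finset.mem_range_succ_iff.mp hm)]
    rw [hF, gaussCoeff]
    simp only [div_eq_mul_inv, mul_inv]
    ring
  · rw [Finset.sum_range_diag_flip]
    refine Finset.sum_congr rfl fun m hm => ?_
    have hmn := Finset.mem_range_succ_iff.mp hm
    rw [Nat.succ_sub hmn, Finset.mul_sum]
    refine Finset.sum_congr rfl fun j _ => ?_
    have hn : -((n - m : ℕ) : ℂ) = -(n : ℂ) + m := by
      rw [Nat.cast_sub hmn]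
      ring
    simp only [F, prod_poch_add, poch_add (-(n : ℂ)), hn, gaussCoeff, binomCoeff, pow_add,
      div_eq_mul_inv, mul_inv]
    ring
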